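/- arXiv:2208.03749 — 3 statements merged into one kernel-verified Lean document; each statement's English description precedes it below -/
import Mathlib

section
/- Let r be a positive integer and a > 0 a real number. For every vector (q₀, q₁, …, q_{2r−1}) of real numbers there exists a unique real polynomial p of degree at most 2r with zero constant term (i.e., p(x) = Σ_{j=1}^{2r} G_j (x/a)^j for some real coefficients G_j) such that p^{(k)}(a) − p^{(k)}(−a) = q_k for every k = 0, 1, …, 2r−1. Equivalently, the 2r × 2r matrix R₁ with entries (R₁)_{k,j} = p_{1,j}^{(k)}(a) − p_{1,j}^{(k)}(−a), where p_{1,j}(x) = (x/a)^j, is invertible. -/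
open Polynomial in
theorem Polynomial.exists_derivative_eq {K : Type*} [Field K] [CharZero K] {n : ℕ} (p : K[X])
    (hp : p.natDegree ≤ n) :
    ∃ P : K[X], P.natDegree ≤ n + 1 ∧ P.coeff 0 = 0 ∧ derivative P = p := by
  refine ⟨∑ i ∈ Finset.range (n + 1), monomial (i + 1) (p.coeff i / (i + 1)), ?_, ?_, ?_⟩
  · refine natDegree_sum_le_of_forall_le _ _ fun i hi => ?_
    exact (natDegree_monomial_le _).trans (Finset.mem_range.mp hi)
  · simp [coeff_monomial]
  · conv_rhs => rw [p.as_sum_range' (n + 1) (by lia)]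
    rw [derivative_sum]
    refine Finset.sum_congr rfl fun i _ => ?_
    rw [derivative_monomial]
    congr 1
    have : (i : K) + 1 ≠ 0 := Nat.cast_add_one_ne_zero i
    push_cast
    field_simp

open Polynomial in
theorem Polynomial.exists_iterate_derivative_eval_sub_eq {K : Type*} [Field K] [CharZero K]
    {a b : K} (hab : a ≠ b) (n : ℕ) (q : ℕ → K) :
    ∃ p : K[X], p.natDegree ≤ n ∧ p.coeff 0 = 0 ∧
      ∀ k < n, (derivative^[k] p).eval a - (derivative^[k] p).eval b = q k := by
  induction n generalizing q with
  | zero => exact ⟨0, by simp⟩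
  | succ n ih =>
    obtain ⟨s, hs, -, hsq⟩ := ih fun k => q (k + 1)
    obtain ⟨S, hS, hS0, rfl⟩ := s.exists_derivative_eq hs
    have hab' : a - b ≠ 0 := sub_ne_zero.mpr hab
    refine ⟨S + C ((q 0 - (S.eval a - S.eval b)) / (a - b)) * X, ?_, ?_, ?_⟩
    · exact natDegree_add_le_of_degree_le hS ((natDegree_C_mul_le _ _).trans (natDegree_X_le.trans (by lia)))
    · simp [hS0]
    · rintro (_ | k) hk
      · simp only [Function.iterate_zero, id_eq, eval_add, eval_mul, eval_C, eval_X]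
        field_simp
        ring
      · rw [← hsq k (by lia), Function.iterate_succ_apply, derivative_add, derivative_C_mul_X,
          iterate_map_add, eval_add, eval_add]
        cases k <;> simp

open Polynomial in
theorem Polynomial.eq_C_of_iterate_derivative_eval_eq {K : Type*} [Field K] [CharZero K]
    {a b : K} (hab : a ≠ b) {n : ℕ} {p : K[X]} (hp : p.natDegree ≤ n)
    (h : ∀ k < n, (derivative^[k] p).eval a = (derivative^[k] p).eval b) :
    p = C (p.coeff 0) := by
  induction n generalizing p with
  | zero => exact eq_C_of_natDegree_le_zero hp
  | succ n ih =>
    have hd := ih ((natDegree_derivative_le p).trans (by lia)) fun k hk => by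
      simpa only [Function.iterate_succ_apply] using h (k + 1) (by lia)
    set c := (derivative p).coeff 0
    have hpc : p - C c * X = C ((p - C c * X).coeff 0) :=
      eq_C_of_natDegree_eq_zero <| derivative_eq_zero.mp <| by
        rw [derivative_sub, derivative_C_mul_X, hd, sub_self]
    have hc : c = 0 := by
      have ha := congrArg (eval a) hpc
      have hb := congrArg (eval b) hpc
      have h0 := h 0 n.succ_pos
      simp only [eval_sub, eval_mul, eval_C, eval_X, Function.iterate_zero, id_eq] at ha hb h0
      have : c * (a - b) = 0 := by linear_combination h0 - ha + hb
      exact (mul_eq_zero.mp this).resolve_right (sub_ne_zero.mpr hab)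
    simpa [hc] using hpc


/-- Invertibility of the boundary-function matrix `R₁` (Eq. (19), Table 1, case 1):
for every positive integer `r`, every `a > 0` and every vector `q : Fin (2r) → ℝ`, there is
a unique real polynomial `p` of degree at most `2r` with zero constant term such that
`p⁽ᵏ⁾(a) − p⁽ᵏ⁾(−a) = qₖ` for every `k = 0, 1, …, 2r − 1`. -/
theorem R1_invertible (r : ℕ) (hr : 0 < r) (a : ℝ) (ha : 0 < a) (q : Fin (2 * r) → ℝ) :
    ∃! p : Polynomial ℝ, p.natDegree ≤ 2 * r ∧ p.coeff 0 = 0 ∧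
      ∀ k : Fin (2 * r),
        (Polynomial.derivative^[(k : ℕ)] p).eval a -
          (Polynomial.derivative^[(k : ℕ)] p).eval (-a) = q k := by
  have hab : a ≠ -a := by linarith
  obtain ⟨p, hp, hp0, hpq⟩ := Polynomial.exists_iterate_derivative_eval_sub_eq hab (2 * r)
    fun k => if hk : k < 2 * r then q ⟨k, hk⟩ else 0
  refine ⟨p, ⟨hp, hp0, fun k => by simpa using hpq k k.isLt⟩, ?_⟩
  rintro s ⟨hs, hs0, hsq⟩
  have hsp := Polynomial.eq_C_of_iterate_derivative_eval_eq hab (p := s - p)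
    ((Polynomial.natDegree_sub_le_of_le hs hp).trans (max_self _).le) fun k hk => by
      have h₁ := hsq ⟨k, hk⟩
      have h₂ := hpq k hk
      rw [dif_pos hk] at h₂
      rw [Polynomial.iterate_derivative_sub, Polynomial.eval_sub, Polynomial.eval_sub]
      linear_combination h₁ - h₂
  simpa [hs0, hp0, sub_eq_zero] using hsp
end

section
/- Let r be a positive integer and a, b > 0 real numbers. For every family (q_{k₁,k₂}) of real numbers indexed by pairs of nonnegative integers with k₁ + k₂ ≤ 2r − 2, there exists a unique real polynomial P in two variables of the form P(x,y) = Σ_{(j,l)∈Ω₃} c_{j,l} (x/a)^j (y/b)^l such that for all nonnegative integers k₁, k₂ with k₁ + k₂ ≤ 2r − 2 the corner double-difference ∂_x^{k₁}∂_y^{k₂}P(a,b) − ∂_x^{k₁}∂_y^{k₂}P(a,−b) − ∂_x^{k₁}∂_y^{k₂}P(−a,b) + ∂_x^{k₁}∂_y^{k₂}P(−a,−b) equals q_{k₁,k₂}. Equivalently, the matrix R₃ formed by these corner double-differences of the monomials indexed by Ω₃ is invertible. -/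
/-- `Ω₃₁ = {(2j+2, 2l+2) : j,l ≥ 0, j+l ≤ r−2}`. -/
def Omega31 (r : ℕ) : Set (ℕ × ℕ) :=
  {p | ∃ j l, j + l + 2 ≤ r ∧ p = (2 * j + 2, 2 * l + 2)}

/-- `Ω₃₂ = {(2j+1, 2l+2) : j,l ≥ 0, j+l ≤ r−2}`. -/
def Omega32 (r : ℕ) : Set (ℕ × ℕ) :=
  {p | ∃ j l, j + l + 2 ≤ r ∧ p = (2 * j + 1, 2 * l + 2)}

/-- `Ω₃₃ = {(2j+2, 2l+1) : j,l ≥ 0, j+l ≤ r−2}`. -/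
def Omega33 (r : ℕ) : Set (ℕ × ℕ) :=
  {p | ∃ j l, j + l + 2 ≤ r ∧ p = (2 * j + 2, 2 * l + 1)}

/-- `Ω₃₄ = {(2j+1, 2l+1) : j,l ≥ 0, j+l ≤ r−1}`. -/
def Omega34 (r : ℕ) : Set (ℕ × ℕ) :=
  {p | ∃ j l, j + l + 1 ≤ r ∧ p = (2 * j + 1, 2 * l + 1)}

/-- `Ω₃ = Ω₃₁ ∪ Ω₃₂ ∪ Ω₃₃ ∪ Ω₃₄`. -/
def Omega3 (r : ℕ) : Set (ℕ × ℕ) := Omega31 r ∪ Omega32 r ∪ Omega33 r ∪ Omega34 r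

/-- The mixed partial derivative `∂ₓ^{k₁} ∂_y^{k₂} f (x, y)` of a two-variable function. -/
noncomputable def partialDeriv2 (f : ℝ → ℝ → ℝ) (k₁ k₂ : ℕ) (x y : ℝ) : ℝ :=
  iteratedDeriv k₁ (fun s => iteratedDeriv k₂ (fun t => f s t) y) x

/-- The corner double-difference
`∂^{(k₁,k₂)}f(a,b) − ∂^{(k₁,k₂)}f(a,−b) − ∂^{(k₁,k₂)}f(−a,b) + ∂^{(k₁,k₂)}f(−a,−b)`. -/
noncomputable def cornerDiff (f : ℝ → ℝ → ℝ) (k₁ k₂ : ℕ) (a b : ℝ) : ℝ :=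
  partialDeriv2 f k₁ k₂ a b - partialDeriv2 f k₁ k₂ a (-b) -
    partialDeriv2 f k₁ k₂ (-a) b + partialDeriv2 f k₁ k₂ (-a) (-b)

theorem mem_Omega3_iff {r : ℕ} {p : ℕ × ℕ} :
    p ∈ Omega3 r ↔ 1 ≤ p.1 ∧ 1 ≤ p.2 ∧ p.1 + p.2 ≤ 2 * r := by
  obtain ⟨m, n⟩ := p
  simp only [Omega3, Omega31, Omega32, Omega33, Omega34, Set.mem_union, Set.mem_ofPred_eq,
    Prod.mk.injEq]
  constructor
  · rintro (((⟨j, l, h⟩ | ⟨j, l, h⟩) | ⟨j, l, h⟩) | ⟨j, l, h⟩) <;> omega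
  · rintro ⟨hm, hn, h⟩
    obtain ⟨j, rfl | rfl⟩ : ∃ j, m = 2 * j + 2 ∨ m = 2 * j + 1 := ⟨(m - 1) / 2, by omega⟩ <;>
    obtain ⟨l, rfl | rfl⟩ : ∃ l, n = 2 * l + 2 ∨ n = 2 * l + 1 := ⟨(n - 1) / 2, by omega⟩
    · exact .inl (.inl (.inl ⟨j, l, by omega, rfl, rfl⟩))
    · exact .inl (.inr ⟨j, l, by omega, rfl, rfl⟩)
    · exact .inl (.inl (.inr ⟨j, l, by omega, rfl, rfl⟩))
    · exact .inr ⟨j, l, by omega, rfl, rfl⟩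

/-- A triangular linear system over a finite set of indices, with nonzero diagonal entries, has
exactly one solution supported on that set. -/
theorem existsUnique_triangular {α K : Type*} [LinearOrder α] [Field K] (s : Finset α)
    (M : α → α → K) (hM : ∀ i j, j < i → M i j = 0) (hd : ∀ i ∈ s, M i i ≠ 0) (q : α → K) :
    ∃! c : α → K, (∀ i, i ∉ s → c i = 0) ∧ ∀ i ∈ s, ∑ j ∈ s, M i j * c j = q i := by
  let A : Matrix s s K := fun i j => M i j
  have hdet : A.det = ∏ i, A i i :=
    Matrix.det_of_isUpperTriangular fun i j hij => hM i j hij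
  have hA : IsUnit A := by
    rw [Matrix.isUnit_iff_isUnit_det, hdet, isUnit_iff_ne_zero]
    exact Finset.prod_ne_zero_iff.mpr fun i _ => hd i i.2
  have hsum (c : α → K) (i : s) :
      A.mulVec (fun j => c j) i = ∑ j ∈ s, M i j * c j :=
    Finset.sum_coe_sort s fun j => M i j * c j
  obtain ⟨v, hv⟩ := Matrix.mulVec_surjective_iff_isUnit.mpr hA fun i => q i
  refine ⟨fun i => if h : i ∈ s then v ⟨i, h⟩ else 0,
    ⟨fun i hi => dif_neg hi, fun i hi => ?_⟩, fun c hc => ?_⟩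
  · rw [← hsum _ ⟨i, hi⟩]
    simpa using congrFun hv ⟨i, hi⟩
  · have hcv : (fun j : s => c j) = v := by
      refine Matrix.mulVec_injective_iff_isUnit.mpr hA (hv ▸ funext fun i => ?_)
      rw [hsum, hc.2 i i.2]
    funext i
    split_ifs with hi
    · exact congrFun hcv ⟨i, hi⟩
    · exact hc.1 i hi

/-- The jump across `[-a, a]` of the `k`-th derivative of `(x / a) ^ n`. -/
noncomputable def monomialJump (a : ℝ) (k n : ℕ) : ℝ :=
  iteratedDeriv k (fun t => (t / a) ^ n) a - iteratedDeriv k (fun t => (t / a) ^ n) (-a)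

theorem iteratedDeriv_div_pow (a x : ℝ) (k n : ℕ) :
    iteratedDeriv k (fun t : ℝ => (t / a) ^ n) x =
      n.descFactorial k * x ^ (n - k) / a ^ n := by
  simp only [div_pow]
  rw [iteratedDeriv_div_const, iteratedDeriv_pow]

theorem monomialJump_of_le (a : ℝ) {k n : ℕ} (h : n ≤ k) : monomialJump a k n = 0 := by
  simp [monomialJump, iteratedDeriv_div_pow, Nat.sub_eq_zero_of_le h]

theorem monomialJump_succ_ne_zero {a : ℝ} (ha : a ≠ 0) (k : ℕ) :
    monomialJump a k (k + 1) ≠ 0 := by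
  have hd : ((k + 1).descFactorial k : ℝ) ≠ 0 := by
    simp [Nat.descFactorial_eq_zero_iff_lt]
  have : monomialJump a k (k + 1) = 2 * ((k + 1).descFactorial k * a / a ^ (k + 1)) := by
    simp only [monomialJump, iteratedDeriv_div_pow, Nat.add_sub_cancel_left, pow_one]
    ring
  rw [this]
  positivity

theorem partialDeriv2_sum_monomials (s : Finset (ℕ × ℕ)) (c : ℕ × ℕ → ℝ) (a b x y : ℝ)
    (k₁ k₂ : ℕ) :
    partialDeriv2 (fun x y => ∑ p ∈ s, c p * (x / a) ^ p.1 * (y / b) ^ p.2) k₁ k₂ x y =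
      ∑ p ∈ s, c p * iteratedDeriv k₁ (fun t => (t / a) ^ p.1) x *
        iteratedDeriv k₂ (fun t => (t / b) ^ p.2) y := by
  unfold partialDeriv2
  have hy (u : ℝ) : iteratedDeriv k₂ (fun t => ∑ p ∈ s, c p * (u / a) ^ p.1 * (t / b) ^ p.2) y =
      ∑ p ∈ s, c p * iteratedDeriv k₂ (fun t => (t / b) ^ p.2) y * (u / a) ^ p.1 := by
    rw [iteratedDeriv_fun_sum fun p _ => by fun_prop]
    refine Finset.sum_congr rfl fun p _ => ?_
    rw [iteratedDeriv_const_mul_field]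
    ring
  simp only [hy]
  rw [iteratedDeriv_fun_sum fun p _ => by fun_prop]
  refine Finset.sum_congr rfl fun p _ => ?_
  rw [iteratedDeriv_const_mul_field]
  ring

theorem cornerDiff_sum_monomials (s : Finset (ℕ × ℕ)) (c : ℕ × ℕ → ℝ) (a b : ℝ) (k₁ k₂ : ℕ) :
    cornerDiff (fun x y => ∑ p ∈ s, c p * (x / a) ^ p.1 * (y / b) ^ p.2) k₁ k₂ a b =
      ∑ p ∈ s, monomialJump a k₁ p.1 * monomialJump b k₂ p.2 * c p := by
  simp only [cornerDiff, partialDeriv2_sum_monomials, ← Finset.sum_sub_distrib,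
    ← Finset.sum_add_distrib, monomialJump]
  exact Finset.sum_congr rfl fun p _ => by ring

/-- Invertibility of the corner-function matrix `R₃` (Eq. (48), Table 1, case 4):
for every family `q` of prescribed corner double-differences indexed by `k₁ + k₂ ≤ 2r − 2`,
there is a unique polynomial `P(x,y) = ∑_{(j,l) ∈ Ω₃} c_{j,l} (x/a)^j (y/b)^l`
realizing them. -/
theorem R3_invertible (r : ℕ) (hr : 0 < r) (a b : ℝ) (ha : 0 < a) (hb : 0 < b)
    (q : ℕ → ℕ → ℝ) :
    ∃! c : ℕ × ℕ → ℝ,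
      (∀ p : ℕ × ℕ, p ∉ Omega3 r → c p = 0) ∧
      ∀ k₁ k₂ : ℕ, k₁ + k₂ ≤ 2 * r - 2 →
        cornerDiff
          (fun x y => ∑ p ∈ Finset.range (2 * r + 1) ×ˢ Finset.range (2 * r + 1),
            c p * (x / a) ^ p.1 * (y / b) ^ p.2) k₁ k₂ a b = q k₁ k₂ := by
  classical
  let S : Finset (ℕ × ℕ) :=
    (Finset.range (2 * r + 1) ×ˢ Finset.range (2 * r + 1)).filter (· ∈ Omega3 r)
  have hS (p : ℕ × ℕ) : p ∈ S ↔ p ∈ Omega3 r := by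
    simp only [S, Finset.mem_filter, Finset.mem_product, Finset.mem_range, mem_Omega3_iff]
    omega
  let M (i j : ℕ × ℕ) : ℝ := monomialJump a (i.1 - 1) j.1 * monomialJump b (i.2 - 1) j.2
  have hM (i j : ℕ × ℕ) (h : j.1 < i.1 ∨ j.1 = i.1 ∧ j.2 < i.2) : M i j = 0 := by
    rcases h with h | ⟨-, h⟩
    · simp [M, monomialJump_of_le a (show j.1 ≤ i.1 - 1 by omega)]
    · simp [M, monomialJump_of_le b (show j.2 ≤ i.2 - 1 by omega)]
  have hd (i : ℕ × ℕ) (hi : i ∈ S) : M i i ≠ 0 := by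
    obtain ⟨h₁, h₂, -⟩ := mem_Omega3_iff.mp ((hS i).mp hi)
    have hx := monomialJump_succ_ne_zero ha.ne' (i.1 - 1)
    have hy := monomialJump_succ_ne_zero hb.ne' (i.2 - 1)
    rw [Nat.sub_add_cancel h₁] at hx
    rw [Nat.sub_add_cancel h₂] at hy
    exact mul_ne_zero hx hy
  have key := existsUnique_triangular (S.map toLex.toEmbedding)
    (fun i j => M (ofLex i) (ofLex j))
    (fun i j hij => hM _ _ (Prod.Lex.lt_iff.mp hij)) (by simpa using hd)
    (fun i => q ((ofLex i).1 - 1) ((ofLex i).2 - 1))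
  have key' : ∃! c : ℕ × ℕ → ℝ, (∀ i, i ∉ S → c i = 0) ∧
      ∀ i ∈ S, ∑ j ∈ S, M i j * c j = q (i.1 - 1) (i.2 - 1) := by
    obtain ⟨c, hc, hu⟩ := key
    simp only [Finset.sum_map, Finset.mem_map_equiv, Lex.forall] at hc hu
    exact ⟨fun p => c (toLex p), hc, fun d hdd => funext fun p =>
      congrFun (hu (fun i => d (ofLex i)) hdd) (toLex p)⟩
  refine (existsUnique_congr fun c => ?_).mp key'
  simp only [hS]
  refine and_congr_right fun hc => ?_
  have hsum (k₁ k₂ : ℕ) :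
      cornerDiff (fun x y => ∑ p ∈ Finset.range (2 * r + 1) ×ˢ Finset.range (2 * r + 1),
        c p * (x / a) ^ p.1 * (y / b) ^ p.2) k₁ k₂ a b =
      ∑ j ∈ S, monomialJump a k₁ j.1 * monomialJump b k₂ j.2 * c j := by
    rw [cornerDiff_sum_monomials, eq_comm]
    refine Finset.sum_subset (Finset.filter_subset _ _) fun p _ hp => ?_
    rw [hc p (mt (hS p).mpr hp), mul_zero]
  simp only [hsum]
  constructor
  · intro h k₁ k₂ hk
    exact h (k₁ + 1, k₂ + 1) (mem_Omega3_iff.mpr ⟨by simp, by simp, by simp only; omega⟩)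
  · intro h i hi
    obtain ⟨h₁, h₂, h₃⟩ := mem_Omega3_iff.mp hi
    exact h (i.1 - 1) (i.2 - 1) (by omega)
end

section
/- Let r be a positive integer, a > 0, and let u : ℝ → ℝ be 2r times continuously differentiable. Then there exists a real polynomial φ₁ of degree at most 2r with zero constant term such that, setting φ₀ = u − φ₁ on [−a,a]: (i) φ₀^{(k)}(a) = φ₀^{(k)}(−a) for all k = 0, 1, …, 2r−1; and (ii) for every k = 0, 1, …, 2r−1 and every x ∈ [−a,a], u^{(k)}(x) = φ₁^{(k)}(x) + lim_{M→∞} Σ_{m=0}^{M} μ_m [V_{1m} (d^k/dx^k) cos(α_m x) + V_{2m} (d^k/dx^k) sin(α_m x)], where α_m = mπ/a, μ₀ = 1/2, μ_m = 1 for m ≥ 1, V_{1m} = (1/a)∫_{−a}^{a} φ₀(t) cos(α_m t) dt, V_{2m} = (1/a)∫_{−a}^{a} φ₀(t) sin(α_m t) dt, and the convergence of the series is uniform on [−a,a]. -/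
open MeasureTheory Filter

/-- The cosine coefficient `(1/a) ∫_{-a}^{a} g(t) cos(αt) dt` of `g` at frequency `α`. -/
noncomputable def cosCoeff (a : ℝ) (g : ℝ → ℝ) (α : ℝ) : ℝ :=
  (1 / a) * ∫ t in (-a)..a, g t * Real.cos (α * t)

/-- The sine coefficient `(1/a) ∫_{-a}^{a} g(t) sin(αt) dt` of `g` at frequency `α`. -/
noncomputable def sinCoeff (a : ℝ) (g : ℝ → ℝ) (α : ℝ) : ℝ :=
  (1 / a) * ∫ t in (-a)..a, g t * Real.sin (α * t)

lemma cosCoeff_neg (a : ℝ) (g : ℝ → ℝ) (α : ℝ) : cosCoeff a g (-α) = cosCoeff a g α := by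
  simp [cosCoeff]

lemma sinCoeff_neg (a : ℝ) (g : ℝ → ℝ) (α : ℝ) : sinCoeff a g (-α) = -sinCoeff a g α := by
  simp [sinCoeff]

lemma cosCoeff_deriv (a : ℝ) {g : ℝ → ℝ} (hg : ContDiff ℝ 1 g) (hp : g a = g (-a)) (α : ℝ) :
    cosCoeff a (deriv g) α = α * sinCoeff a g α := by
  have h := intervalIntegral.integral_deriv_mul_eq_sub (a := -a) (b := a)
    (u := g) (v := fun t => Real.cos (α * t)) (u' := deriv g)
    (v' := fun t => -Real.sin (α * t) * (α * 1))
    (fun x _ => (hg.differentiable one_ne_zero x).hasDerivAt)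
    (fun x _ => ((hasDerivAt_id' x).const_mul α).cos)
    (hg.continuous_deriv_one.intervalIntegrable _ _)
    (by apply Continuous.intervalIntegrable; fun_prop)
  have hg0 := hg.continuous
  have hg1 := hg.continuous_deriv_one
  rw [intervalIntegral.integral_add (by apply Continuous.intervalIntegrable; fun_prop)
    (by apply Continuous.intervalIntegrable; fun_prop)] at h
  have e : ∫ t in (-a)..a, g t * (-Real.sin (α * t) * (α * 1))
      = -α * ∫ t in (-a)..a, g t * Real.sin (α * t) := by
    rw [← intervalIntegral.integral_const_mul]
    congr 1; ext t; ring
  rw [e, hp] at h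
  simp only [mul_neg, Real.cos_neg, sub_self] at h
  unfold cosCoeff sinCoeff
  linear_combination (1 / a) * h

lemma sinCoeff_deriv (a : ℝ) {g : ℝ → ℝ} (hg : ContDiff ℝ 1 g) (α : ℝ)
    (hα : Real.sin (α * a) = 0) :
    sinCoeff a (deriv g) α = -α * cosCoeff a g α := by
  have h := intervalIntegral.integral_deriv_mul_eq_sub (a := -a) (b := a)
    (u := g) (v := fun t => Real.sin (α * t)) (u' := deriv g)
    (v' := fun t => Real.cos (α * t) * (α * 1))
    (fun x _ => (hg.differentiable one_ne_zero x).hasDerivAt)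
    (fun x _ => ((hasDerivAt_id' x).const_mul α).sin)
    (hg.continuous_deriv_one.intervalIntegrable _ _)
    (by apply Continuous.intervalIntegrable; fun_prop)
  have hg0 := hg.continuous
  have hg1 := hg.continuous_deriv_one
  rw [intervalIntegral.integral_add (by apply Continuous.intervalIntegrable; fun_prop)
    (by apply Continuous.intervalIntegrable; fun_prop)] at h
  have e : ∫ t in (-a)..a, g t * (Real.cos (α * t) * (α * 1))
      = α * ∫ t in (-a)..a, g t * Real.cos (α * t) := by
    rw [← intervalIntegral.integral_const_mul]
    congr 1; ext t; ring
  rw [e] at h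
  simp only [mul_neg, Real.sin_neg, hα, mul_zero, neg_zero, sub_self] at h
  unfold cosCoeff sinCoeff
  linear_combination (1 / a) * h

/-- The `k`-th derivative of a harmonic of `g` is the corresponding harmonic of `g⁽ᵏ⁾`, provided
the derivatives of `g` of order less than `k` agree at the endpoints. -/
lemma iteratedDeriv_harmonic (a α : ℝ) (hα : Real.sin (α * a) = 0) (k : ℕ) {g : ℝ → ℝ}
    (hg : ContDiff ℝ k g) (hp : ∀ j < k, iteratedDeriv j g a = iteratedDeriv j g (-a)) (x : ℝ) :
    cosCoeff a g α * iteratedDeriv k (fun y => Real.cos (α * y)) x +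
        sinCoeff a g α * iteratedDeriv k (fun y => Real.sin (α * y)) x =
      cosCoeff a (iteratedDeriv k g) α * Real.cos (α * x) +
        sinCoeff a (iteratedDeriv k g) α * Real.sin (α * x) := by
  induction k generalizing g with
  | zero => simp
  | succ k ih =>
    have hg1 : ContDiff ℝ 1 g := hg.of_le (by exact_mod_cast Nat.le_add_left 1 k)
    have hg' : ContDiff ℝ k (deriv g) := (contDiff_succ_iff_deriv.mp hg).2.2
    have hc : deriv (fun y => Real.cos (α * y)) = fun y => -α * Real.sin (α * y) := by
      ext y
      rw [(((hasDerivAt_id' y).const_mul α).cos).deriv]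
      simp; ring
    have hs : deriv (fun y => Real.sin (α * y)) = fun y => α * Real.cos (α * y) := by
      ext y
      rw [(((hasDerivAt_id' y).const_mul α).sin).deriv]
      simp; ring
    have h := ih hg' fun j hj => by
      simpa only [iteratedDeriv_succ'] using hp (j + 1) (by omega)
    rw [cosCoeff_deriv a hg1 (by simpa using hp 0 (by omega)) α, sinCoeff_deriv a hg1 α hα] at h
    simp only [iteratedDeriv_succ', hc, hs, iteratedDeriv_const_mul_field]
    rw [← h]
    ring

lemma fourier_coe_eq_cos_add_sin (a : ℝ) (n : ℤ) (x : ℝ) :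
    fourier n (x : AddCircle (a - -a)) =
      (Real.cos (n * Real.pi / a * x) : ℂ) + (Real.sin (n * Real.pi / a * x) : ℂ) * Complex.I := by
  rw [fourier_coe_apply, Complex.ofReal_cos, Complex.ofReal_sin, ← Complex.exp_mul_I]
  congr 1
  push_cast
  rw [sub_neg_eq_add, ← two_mul]
  rcases eq_or_ne (a : ℂ) 0 with h | h
  · simp [h]
  · field_simp

lemma fourierCoeffOn_eq_cosCoeff_sub_sinCoeff {a : ℝ} (hab : -a < a) {g : ℝ → ℝ}
    (hg : Continuous g) (n : ℤ) :
    fourierCoeffOn hab (fun x => (g x : ℂ)) n =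
      ((cosCoeff a g (n * Real.pi / a) : ℂ) - sinCoeff a g (n * Real.pi / a) * Complex.I) / 2 := by
  have e : (fun t : ℝ => fourier (-n) (t : AddCircle (a - -a)) • (g t : ℂ)) = fun t =>
      ((g t * Real.cos (n * Real.pi / a * t) : ℝ) : ℂ) -
        ((g t * Real.sin (n * Real.pi / a * t) : ℝ) : ℂ) * Complex.I := by
    ext t
    rw [fourier_coe_eq_cos_add_sin]
    have : ((-n : ℤ) : ℝ) * Real.pi / a * t = -(n * Real.pi / a * t) := by push_cast; ring
    rw [this, Real.cos_neg, Real.sin_neg]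
    simp only [smul_eq_mul]
    push_cast
    ring
  rw [fourierCoeffOn_eq_integral, e, intervalIntegral.integral_sub
    (by apply Continuous.intervalIntegrable; fun_prop)
    (by apply Continuous.intervalIntegrable; fun_prop), intervalIntegral.integral_mul_const,
    intervalIntegral.integral_ofReal, intervalIntegral.integral_ofReal]
  unfold cosCoeff sinCoeff
  rw [Complex.real_smul]
  have ha : (a : ℂ) ≠ 0 := by
    have : a ≠ 0 := by rintro rfl; simp at hab
    exact_mod_cast this
  push_cast
  rw [sub_neg_eq_add, ← two_mul]
  field_simp

lemma summable_fourierCoeffOn_of_contDiff {a : ℝ} (hab : -a < a) {g : ℝ → ℝ}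
    (hg : ContDiff ℝ 1 g) (hp : g a = g (-a)) :
    Summable (fourierCoeffOn hab (fun x => (g x : ℂ))) := by
  have hg1 : Continuous (fun x => ((deriv g x : ℝ) : ℂ)) :=
    Complex.continuous_ofReal.comp' hg.continuous_deriv_one
  have hL2 : MemLp (fun x => ((deriv g x : ℝ) : ℂ)) 2 (volume.restrict (Set.Ioc (-a) a)) :=
    (memLp_two_iff_integrable_sq_norm hg1.aestronglyMeasurable).mpr
      (hg1.norm.pow 2).integrableOn_Ioc
  have hs := (hasSum_sq_fourierCoeffOn hab hL2).summable
  have hn : Summable fun n : ℤ => 1 / (n : ℝ) ^ 2 := Real.summable_one_div_int_pow.mpr one_lt_two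
  refine Summable.of_norm_bounded_eventually (g := fun n : ℤ =>
    (2 * a / (2 * Real.pi)) * ((1 / (n : ℝ) ^ 2 +
      ‖fourierCoeffOn hab (fun x => ((deriv g x : ℝ) : ℂ)) n‖ ^ 2) / 2))
    (((hn.add hs).div_const 2).mul_left _) ?_
  rw [Filter.eventually_cofinite]
  refine (Set.finite_singleton 0).subset fun n h => ?_
  by_contra h0
  refine h ?_
  rw [fourierCoeffOn_of_hasDerivAt hab h0
    (fun x _ => ((hg.differentiable one_ne_zero x).hasDerivAt).ofReal_comp)
    (hg1.intervalIntegrable _ _), hp, sub_self, mul_zero, zero_sub]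
  have ha : 0 < a := by linarith
  have hnn : 0 < |(n : ℝ)| := abs_pos.mpr (by exact_mod_cast h0)
  have e : ((a : ℂ) - ((-a : ℝ) : ℂ)) = ((2 * a : ℝ) : ℂ) := by push_cast; ring
  rw [e]
  simp only [norm_mul, norm_div, norm_neg, Complex.norm_real, Complex.norm_I, norm_one,
    Complex.norm_intCast, Real.norm_eq_abs, abs_of_pos ha, abs_of_pos Real.pi_pos, abs_two,
    Complex.norm_ofNat, mul_one]
  set c := ‖fourierCoeffOn hab (fun x => ((deriv g x : ℝ) : ℂ)) n‖
  have h1 : 1 / (2 * Real.pi * |(n : ℝ)|) * (2 * a * c) =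
      (2 * a / (2 * Real.pi)) * (1 / |(n : ℝ)| * c) := by
    field_simp
  rw [h1]
  refine mul_le_mul_of_nonneg_left ?_ (by positivity)
  rw [← sq_abs (n : ℝ)]
  have := two_mul_le_add_sq (1 / |(n : ℝ)|) c
  rw [div_pow, one_pow] at this
  linarith

/-- The full-range Fourier series of a `C¹` function with equal endpoint values converges
uniformly. -/
lemma tendstoUniformlyOn_fourier_series {a : ℝ} (ha : 0 < a) {g : ℝ → ℝ}
    (hg : ContDiff ℝ 1 g) (hp : g a = g (-a)) :
    TendstoUniformlyOn
      (fun M : ℕ => fun x : ℝ => ∑ m ∈ Finset.range (M + 1), (if m = 0 then (1 / 2 : ℝ) else 1) *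
        (cosCoeff a g (m * Real.pi / a) * Real.cos (m * Real.pi / a * x) +
          sinCoeff a g (m * Real.pi / a) * Real.sin (m * Real.pi / a * x)))
      g atTop (Set.Icc (-a) a) := by
  have hab : -a < a := by linarith
  have : Fact (0 < a - -a) := ⟨by linarith⟩
  set f : ℝ → ℂ := fun x => (g x : ℂ) with hf
  have hfp : f (-a) = f (-a + (a - -a)) := by simp [hf, hp]
  have hfc : Continuous f := Complex.continuous_ofReal.comp hg.continuous
  let F : C(AddCircle (a - -a), ℂ) :=
    ⟨AddCircle.liftIoc (a - -a) (-a) f, AddCircle.liftIoc_continuous hfp hfc.continuousOn⟩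
  have hF : ∀ x ∈ Set.Icc (-a) a, F (x : AddCircle (a - -a)) = f x := by
    intro x hx
    rcases eq_or_lt_of_le hx.1 with h | h
    · change AddCircle.liftIoc (a - -a) (-a) f _ = _
      rw [AddCircle.liftIoc_eq_liftIco hfp]
      exact AddCircle.liftIco_coe_apply ⟨hx.1, by linarith⟩
    · change AddCircle.liftIoc (a - -a) (-a) f _ = _
      exact AddCircle.liftIoc_coe_apply (p := a - -a) ⟨h, by linarith [hx.2]⟩
  have hcoeff : fourierCoeff F = fourierCoeffOn hab f := rfl
  have hsum := hasSum_fourier_series_of_summable (f := F)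
    (by rw [hcoeff]; exact summable_fourierCoeffOn_of_contDiff hab hg hp)
  have ht := (((hsum.nat_add_neg).tendsto_sum_nat).comp (tendsto_add_atTop_nat 1)).sub_const
    (fourierCoeff F 0 • fourier 0)
  rw [add_sub_cancel_right, ContinuousMap.tendsto_iff_tendstoUniformly,
    Metric.tendstoUniformly_iff] at ht
  rw [Metric.tendstoUniformlyOn_iff]
  intro ε hε
  filter_upwards [ht ε hε] with M hM x hx
  convert hM (x : AddCircle (a - -a)) using 1
  rw [hF x hx, ← Complex.isometry_ofReal.dist_eq]
  congr 1
  have hz : ∀ n : ℤ, (fourierCoeff F n • fourier n : C(AddCircle (a - -a), ℂ)) x =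
      ((cosCoeff a g (n * Real.pi / a) : ℂ) - sinCoeff a g (n * Real.pi / a) * Complex.I) / 2 *
      ((Real.cos (n * Real.pi / a * x) : ℂ) + (Real.sin (n * Real.pi / a * x) : ℂ) * Complex.I) := by
    intro n
    rw [ContinuousMap.smul_apply, smul_eq_mul, fourier_coe_eq_cos_add_sin, hcoeff,
      fourierCoeffOn_eq_cosCoeff_sub_sinCoeff hab hg.continuous]
  have hpair : ∀ m : ℕ, (fourierCoeff F (m : ℤ) • fourier (m : ℤ) +
      fourierCoeff F (-(m : ℤ)) • fourier (-(m : ℤ)) : C(AddCircle (a - -a), ℂ)) x =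
      ((cosCoeff a g (m * Real.pi / a) * Real.cos (m * Real.pi / a * x) +
          sinCoeff a g (m * Real.pi / a) * Real.sin (m * Real.pi / a * x) : ℝ) : ℂ) := by
    intro m
    have e : ((-(m : ℤ) : ℤ) : ℝ) * Real.pi / a = -(m * Real.pi / a) := by push_cast; ring
    rw [ContinuousMap.add_apply, hz, hz, e, cosCoeff_neg, sinCoeff_neg, neg_mul, Real.cos_neg,
      Real.sin_neg, Int.cast_natCast]
    push_cast
    linear_combination (-(sinCoeff a g (m * Real.pi / a) : ℂ) *
      Complex.sin (m * Real.pi / a * x)) * Complex.I_sq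
  rw [ContinuousMap.sub_apply, Function.comp_apply, ContinuousMap.sum_apply,
    Finset.sum_congr rfl fun m _ => hpair m, hz 0, Finset.sum_range_succ',
    Finset.sum_range_succ' _ M]
  simp [sinCoeff]
  ring

lemma iteratedDeriv_polynomial_eval (P : Polynomial ℝ) (k : ℕ) :
    iteratedDeriv k (fun x => P.eval x) = fun x => (Polynomial.derivative^[k] P).eval x := by
  induction k generalizing P with
  | zero => simp
  | succ k ih =>
    have : deriv (fun x => P.eval x) = fun x => P.derivative.eval x := by ext; simp
    rw [iteratedDeriv_succ', this, ih, Function.iterate_succ_apply]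

/-- Endpoint jumps of the derivatives of order less than `n` can be prescribed arbitrarily by a
polynomial of degree at most `n` without constant term. -/
lemma exists_polynomial_endpoint_jumps {a : ℝ} (ha : a ≠ 0) (n : ℕ) (d : ℕ → ℝ) :
    ∃ P : Polynomial ℝ, P.natDegree ≤ n ∧ P.coeff 0 = 0 ∧ ∀ k < n,
      (Polynomial.derivative^[k] P).eval a - (Polynomial.derivative^[k] P).eval (-a) = d k := by
  induction n generalizing d with
  | zero => exact ⟨0, by simp⟩
  | succ n ih =>
    set c : ℝ := d n / ((n + 1).descFactorial n * (2 * a)) with hc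
    let Q : Polynomial ℝ := Polynomial.C c * Polynomial.X ^ (n + 1)
    obtain ⟨P, hdeg, h0, hP⟩ := ih fun k => d k -
      ((Polynomial.derivative^[k] Q).eval a - (Polynomial.derivative^[k] Q).eval (-a))
    refine ⟨P + Q, ?_, by simp [Q, h0], fun k hk => ?_⟩
    · exact Polynomial.natDegree_add_le_of_degree_le (by omega)
        (Polynomial.natDegree_C_mul_X_pow_le _ _)
    · rw [iterate_map_add, Polynomial.eval_add, Polynomial.eval_add]
      rcases Nat.lt_succ_iff_lt_or_eq.mp hk with h | rfl
      · linarith [hP k h]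
      · have hconst : (Polynomial.derivative^[k] P).natDegree = 0 := by
          have := Polynomial.natDegree_iterate_derivative P k
          omega
        have hfac : ((k + 1).descFactorial k : ℝ) ≠ 0 := by
          exact_mod_cast (Nat.descFactorial_pos.mpr (Nat.le_succ k)).ne'
        rw [Polynomial.eq_C_of_natDegree_eq_zero hconst]
        simp only [Q, Polynomial.iterate_derivative_C_mul,
          Polynomial.iterate_derivative_X_pow_eq_natCast_mul, Polynomial.eval_mul,
          Polynomial.eval_C, Polynomial.eval_natCast, Polynomial.eval_X,
          Nat.add_sub_cancel_left, pow_one, hc]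
        field_simp
        ring

/-- One-dimensional composite Fourier series representation (Section 3.1, Eq. (41)):
if `u` is `2r` times continuously differentiable, there is a polynomial boundary
function `φ₁` of degree at most `2r` with zero constant term such that the internal
function `φ₀ = u − φ₁` has matching endpoint derivatives up to order `2r − 1`, and for
every `k = 0, 1, …, 2r − 1` the `k`-times term-by-term differentiated full-range Fourier
series of `φ₀` converges uniformly on `[−a,a]` to `u⁽ᵏ⁾ − φ₁⁽ᵏ⁾`, i.e.
`u⁽ᵏ⁾(x) = φ₁⁽ᵏ⁾(x) + lim S_M⁽ᵏ⁾(x)` uniformly in `x ∈ [−a,a]`. -/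
theorem composite_fourier_series (r : ℕ) (hr : 0 < r) (a : ℝ) (ha : 0 < a)
    (u : ℝ → ℝ) (hu : ContDiff ℝ ((2 * r : ℕ) : ℕ∞) u) :
    ∃ φ₁ : Polynomial ℝ, φ₁.natDegree ≤ 2 * r ∧ φ₁.coeff 0 = 0 ∧
      (∀ k : ℕ, k ≤ 2 * r - 1 →
        iteratedDeriv k (fun x => u x - φ₁.eval x) a =
          iteratedDeriv k (fun x => u x - φ₁.eval x) (-a)) ∧
      ∀ k : ℕ, k ≤ 2 * r - 1 →
        TendstoUniformlyOn
          (fun M : ℕ => fun x : ℝ =>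
            ∑ m ∈ Finset.range (M + 1),
              (if m = 0 then (1 / 2 : ℝ) else 1) *
                (((1 / a) * ∫ t in (-a)..a,
                      (u t - φ₁.eval t) * Real.cos (m * Real.pi / a * t)) *
                    iteratedDeriv k (fun y => Real.cos (m * Real.pi / a * y)) x +
                  ((1 / a) * ∫ t in (-a)..a,
                      (u t - φ₁.eval t) * Real.sin (m * Real.pi / a * t)) *
                    iteratedDeriv k (fun y => Real.sin (m * Real.pi / a * y)) x))
          (fun x => iteratedDeriv k u x - iteratedDeriv k (fun y => φ₁.eval y) x)
          atTop (Set.Icc (-a) a) := by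
  obtain ⟨P, hdeg, h0, hP⟩ := exists_polynomial_endpoint_jumps ha.ne' (2 * r)
    fun k => iteratedDeriv k u a - iteratedDeriv k u (-a)
  have hu' : ContDiff ℝ (2 * r : ℕ) u := by exact_mod_cast hu
  have hPc : ContDiff ℝ (2 * r : ℕ) fun x => P.eval x := P.contDiff_aeval _
  have hsub : ∀ k ≤ 2 * r, ∀ x, iteratedDeriv k (fun x => u x - P.eval x) x =
      iteratedDeriv k u x - iteratedDeriv k (fun y => P.eval y) x := fun k hk x =>
    iteratedDeriv_fun_sub (hu'.of_le (by exact_mod_cast hk)).contDiffAt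
      (hPc.of_le (by exact_mod_cast hk)).contDiffAt
  have hg : ContDiff ℝ (2 * r : ℕ) fun x => u x - P.eval x := hu'.sub hPc
  have hjump : ∀ k : ℕ, k ≤ 2 * r - 1 → iteratedDeriv k (fun x => u x - P.eval x) a =
      iteratedDeriv k (fun x => u x - P.eval x) (-a) := fun k hk => by
    rw [hsub k (by omega), hsub k (by omega), iteratedDeriv_polynomial_eval]
    linarith [hP k (by omega)]
  refine ⟨P, hdeg, h0, hjump, fun k hk => ?_⟩
  have hgk : ContDiff ℝ 1 (iteratedDeriv k fun x => u x - P.eval x) := by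
    rw [iteratedDeriv_eq_iterate]
    exact ContDiff.iterate_deriv' 1 k (hg.of_le (by exact_mod_cast (by omega : 1 + k ≤ 2 * r)))
  have hlim := tendstoUniformlyOn_fourier_series ha hgk (hjump k hk)
  refine (hlim.congr_right fun x _ => hsub k (by omega) x).congr (.of_forall fun M x _ => ?_)
  refine Finset.sum_congr rfl fun m _ => ?_
  have hm : Real.sin (m * Real.pi / a * a) = 0 := by
    rw [div_mul_cancel₀ _ ha.ne', Real.sin_nat_mul_pi]
  exact congrArg _ (iteratedDeriv_harmonic a _ hm k
    (hg.of_le (by exact_mod_cast (by omega : k ≤ 2 * r)))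
    (fun j hj => hjump j (by omega)) x).symm
end
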